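/- arXiv:2403.06593 — 2 statements merged into one kernel-verified Lean document; each statement's English description precedes it below -/
import Mathlib

section
/- For any real z > 0 and any probability distribution p on a finite nonempty set 𝒳 with |𝒳| = n, the spike entropy satisfies S(p, z) ≤ n/(n + z), with equality if and only if p is the uniform distribution on 𝒳 (i.e., p(x) = 1/n for all x ∈ 𝒳). -/
/-- Spike entropy of a probability distribution `p` on a finite set with modulus `z`:
`S(p, z) = ∑ x, p x / (1 + z * p x)`. -/
noncomputable def spikeEntropy {𝒳 : Type*} [Fintype 𝒳] (p : 𝒳 → ℝ) (z : ℝ) : ℝ :=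
  ∑ x, p x / (1 + z * p x)

/-- The deficit of the spike entropy from its maximum is a weighted sum of squared deviations
from the uniform distribution. -/
theorem div_sub_spikeEntropy {𝒳 : Type*} [Fintype 𝒳] [Nonempty 𝒳] (p : 𝒳 → ℝ) {z : ℝ}
    (hz : 0 < z) (hp0 : ∀ x, 0 ≤ p x) (hp1 : ∑ x, p x = 1) :
    (Fintype.card 𝒳 : ℝ) / (Fintype.card 𝒳 + z) - spikeEntropy p z =
      ∑ x, z * (Fintype.card 𝒳 * p x - 1) ^ 2 /
        ((Fintype.card 𝒳 + z) ^ 2 * (1 + z * p x)) := by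
  set n : ℝ := (Fintype.card 𝒳 : ℝ) with hn
  have hn0 : 0 < n := by rw [hn]; exact_mod_cast Fintype.card_pos
  have hnz : n + z ≠ 0 := by positivity
  have tangent (x : 𝒳) : z * (n * p x - 1) ^ 2 / ((n + z) ^ 2 * (1 + z * p x)) =
      z / (n + z) ^ 2 + n ^ 2 / (n + z) ^ 2 * p x - p x / (1 + z * p x) := by
    have : 1 + z * p x ≠ 0 := by have := hp0 x; positivity
    field_simp
    ring
  simp_rw [tangent]
  rw [Finset.sum_sub_distrib, Finset.sum_add_distrib, ← Finset.mul_sum, hp1, Finset.sum_const,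
    Finset.card_univ, nsmul_eq_mul, ← hn, spikeEntropy]
  field_simp
  ring

/-- `S(p, z) ≤ n/(n+z)` where `n = |𝒳|`, with equality iff `p` is the uniform
distribution on `𝒳`. -/
theorem spikeEntropy_le
    {𝒳 : Type*} [Fintype 𝒳] [Nonempty 𝒳] (p : 𝒳 → ℝ) (z : ℝ) (n : ℕ)
    (hn : Fintype.card 𝒳 = n) (hz : 0 < z)
    (hp0 : ∀ x, 0 ≤ p x) (hp1 : ∑ x, p x = 1) :
    spikeEntropy p z ≤ (n : ℝ) / ((n : ℝ) + z) ∧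
      (spikeEntropy p z = (n : ℝ) / ((n : ℝ) + z) ↔ ∀ x, p x = 1 / (n : ℝ)) := by
  subst hn
  have hn0 : (0 : ℝ) < Fintype.card 𝒳 := by exact_mod_cast Fintype.card_pos
  have hden (x : 𝒳) : 0 < (Fintype.card 𝒳 + z) ^ 2 * (1 + z * p x) := by
    have := hp0 x
    positivity
  have hterm (x : 𝒳) : 0 ≤ z * (Fintype.card 𝒳 * p x - 1) ^ 2 /
      ((Fintype.card 𝒳 + z) ^ 2 * (1 + z * p x)) :=
    div_nonneg (by positivity) (hden x).le
  have hdeficit := div_sub_spikeEntropy p hz hp0 hp1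
  refine ⟨sub_nonneg.1 (hdeficit ▸ Finset.sum_nonneg fun x _ => hterm x), ?_⟩
  rw [eq_comm, ← sub_eq_zero, hdeficit, Finset.sum_eq_zero_iff_of_nonneg fun x _ => hterm x]
  simp only [Finset.mem_univ, forall_const]
  refine forall_congr' fun x => ?_
  rw [div_eq_zero_iff, or_iff_left (hden x).ne', mul_eq_zero, or_iff_right hz.ne',
    sq_eq_zero_iff, sub_eq_zero, eq_div_iff hn0.ne', mul_comm]
end

section
/- Let p ∈ (0,1), let U be a random variable uniformly distributed on [0,1], and define the watermarked bit X by X = 1 if U < p and X = 0 otherwise. Then the expected single-token detection score satisfies E[s(X, U)] = 1 + H_b(p), where H_b(p) = −p·ln p − (1−p)·ln(1−p) is the binary Shannon entropy of p in nats. That is, the expected detection score of a watermarked token exceeds that of a non-watermarked token by exactly the Shannon entropy of the token distribution. -/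
open MeasureTheory ProbabilityTheory

/-- The single-token detection score of Christ et al.:
`s(x,u) = ln(1/u)` if the bit `x` is `1` (`true`), and `ln(1/(1-u))` if `x` is `0`. -/
noncomputable def detScore (x : Bool) (u : ℝ) : ℝ :=
  if x then Real.log (1 / u) else Real.log (1 / (1 - u))

/-- The binary Shannon entropy (in nats) of `p`:
`H_b(p) = -p ln p - (1-p) ln (1-p)`. -/
noncomputable def binaryEntropy (p : ℝ) : ℝ :=
  -p * Real.log p - (1 - p) * Real.log (1 - p)

/-- On the watermarked token the score is `-log u` below `p` and `-log (1 - u)` above it. -/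
theorem detScore_decide_lt (p u : ℝ) :
    detScore (decide (u < p)) u = if u < p then -Real.log u else -Real.log (1 - u) := by
  simp [detScore]

theorem integral_detScore_decide_lt {p : ℝ} (hp : p ∈ Set.Ioo (0 : ℝ) 1) :
    ∫ u in (0 : ℝ)..1, detScore (decide (u < p)) u = 1 + binaryEntropy p := by
  have hlow : Set.EqOn (fun u : ℝ => -Real.log u) (fun u => detScore (decide (u < p)) u)
      (Set.uIoo 0 p) := by
    intro u hu
    rw [Set.uIoo_of_le hp.1.le] at hu
    simp [detScore, hu.2]
  have hhigh : Set.EqOn (fun u : ℝ => -Real.log (1 - u)) (fun u => detScore (decide (u < p)) u)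
      (Set.uIoo p 1) := by
    intro u hu
    rw [Set.uIoo_of_le hp.2.le] at hu
    simp [detScore, hu.1.not_gt]
  have ilow : IntervalIntegrable (fun u : ℝ => -Real.log u) volume 0 p :=
    intervalIntegral.intervalIntegrable_log'.neg
  have ihigh : IntervalIntegrable (fun u : ℝ => -Real.log (1 - u)) volume p 1 := by
    have h : IntervalIntegrable Real.log volume (1 - p) 0 :=
      intervalIntegral.intervalIntegrable_log'
    simpa [Pi.neg_def] using (h.comp_sub_left 1).neg
  rw [← intervalIntegral.integral_add_adjacent_intervals (ilow.congr_uIoo hlow)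
      (ihigh.congr_uIoo hhigh),
    ← intervalIntegral.integral_congr_uIoo hlow, ← intervalIntegral.integral_congr_uIoo hhigh,
    intervalIntegral.integral_neg, intervalIntegral.integral_neg,
    intervalIntegral.integral_comp_sub_left (fun u => Real.log u), integral_log, integral_log]
  simp only [binaryEntropy, Real.log_zero, sub_self]
  ring

theorem measurable_detScore_decide_lt (p : ℝ) :
    Measurable fun u : ℝ => detScore (decide (u < p)) u := by
  simp only [detScore_decide_lt]
  exact Measurable.ite measurableSet_Iio (by fun_prop) (by fun_prop)

/-- If `U` is uniform on `[0,1]` and the watermarked bit is `X = 1` iff `U < p`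
(for `p ∈ (0,1)`), then `E[s(X,U)] = 1 + H_b(p)`: the expected detection score
of a watermarked token exceeds that of a non-watermarked token by exactly the
Shannon entropy of the token distribution. -/
theorem expected_detScore_watermarked
    {Ω : Type*} [MeasurableSpace Ω] (μ : Measure Ω) [IsProbabilityMeasure μ]
    (p : ℝ) (hp : p ∈ Set.Ioo (0 : ℝ) 1)
    (U : Ω → ℝ) (hU : Measurable U)
    (hUunif : μ.map U = volume.restrict (Set.Icc (0 : ℝ) 1))
    (X : Ω → Bool) (hX : ∀ ω, X ω = decide (U ω < p)) :
    ∫ ω, detScore (X ω) (U ω) ∂μ = 1 + binaryEntropy p := by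
  simp only [hX]
  rw [← integral_map hU.aemeasurable
      (f := fun u => detScore (decide (u < p)) u)
      (measurable_detScore_decide_lt p).aestronglyMeasurable,
    hUunif, integral_Icc_eq_integral_Ioc, ← intervalIntegral.integral_of_le zero_le_one,
    integral_detScore_decide_lt hp]
end
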